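/- arXiv:2405.00382 — 4 statements merged into one kernel-verified Lean document; each statement's English description precedes it below -/
import Mathlib

section
/- Let 0 = λ₀ < λ₁ < λ₂ < ⋯ be a strictly increasing sequence of real numbers tending to +∞ with λ₀ = 0 and Σ_{i=1}^∞ 1/λ_i = +∞. Then the linear span of the functions x ↦ x^{λ_i} (i ∈ ℕ) is dense in the space C([0,1]) of continuous real-valued functions on [0,1] equipped with the supremum norm. -/
open Filter

lemma golitschek (Λ : ℕ → ℝ) (hpos : ∀ i, 0 < Λ (i+1)) (hmono : StrictMono Λ) (q : ℝ)
    (hq0 : 0 ≤ q) (hq : ∀ i, q ≠ Λ i) (n : ℕ) : ∃ a : ℕ → ℝ, ∀ x : ℝ, 0 < x → x ≤ 1 →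
      |x ^ q - ∑ i ∈ Finset.range n, a i * x ^ (Λ (i+1))| ≤
        ∏ i ∈ Finset.range n, |1 - q / Λ (i+1)| := by
  induction n with
  | zero =>
    refine ⟨0, fun x hx hx1 => ?_⟩
    have hq0 : x ^ q ≤ 1 := Real.rpow_le_one hx.le hx1 hq0
    simpa [abs_of_nonneg (Real.rpow_nonneg hx.le q)] using hq0
  | succ n ih =>
    obtain ⟨a, ha⟩ := ih
    set l := Λ (n+1) with hl
    have hlpos : 0 < l := hpos n
    set C := ∏ i ∈ Finset.range n, |1 - q / Λ (i+1)| with hC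
    have hlq : l - q ≠ 0 := sub_ne_zero.2 (hq _).symm
    have hmu : ∀ i ∈ Finset.range n, Λ (i+1) - l ≠ 0 := by
      intro i hi
      rw [Finset.mem_range] at hi
      have : Λ (i+1) < l := hmono (by omega)
      linarith
    refine ⟨fun i => if i = n then 1 + ∑ i ∈ Finset.range n, a i * ((l - q) / (Λ (i+1) - l))
      else - (a i * ((l - q) / (Λ (i+1) - l))), fun x hx hx1 => ?_⟩
    have hnot : (0:ℝ) ∉ Set.uIcc x 1 := by
      rw [Set.uIcc_of_le hx1]
      exact fun h => absurd h.1 (not_le.2 hx)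
    have hint : ∀ r : ℝ, IntervalIntegrable (fun t : ℝ => t ^ r) MeasureTheory.volume x 1 :=
      fun r => intervalIntegral.intervalIntegrable_rpow (Or.inr hnot)
    have hval : ∀ m : ℝ, m - l ≠ 0 →
        x ^ l * ∫ t in x..1, t ^ (m - 1 - l) = (x ^ l - x ^ m) / (m - l) := by
      intro m hm
      rw [integral_rpow (Or.inr ⟨fun h => hm (by linarith), hnot⟩)]
      rw [show m - 1 - l + 1 = m - l by ring, Real.one_rpow, ← mul_div_assoc, mul_sub,
        ← Real.rpow_add hx, mul_one]
      congr 3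
      ring
    have hI : x ^ q - ∑ i ∈ Finset.range (n+1), (if i = n then
        1 + ∑ i ∈ Finset.range n, a i * ((l - q) / (Λ (i+1) - l))
        else - (a i * ((l - q) / (Λ (i+1) - l)))) * x ^ (Λ (i+1)) =
        (l - q) * (x ^ l * ∫ t in x..1,
          (t ^ (q - 1 - l) - ∑ i ∈ Finset.range n, a i * t ^ (Λ (i+1) - 1 - l))) := by
      have hsum : IntervalIntegrable
          (fun t : ℝ => ∑ i ∈ Finset.range n, a i * t ^ (Λ (i+1) - 1 - l))
          MeasureTheory.volume x 1 := by
        have := IntervalIntegrable.sum (Finset.range n)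
          (f := fun i (t : ℝ) => a i * t ^ (Λ (i+1) - 1 - l))
          (fun i _ => (hint _).const_mul _)
        have e : (fun t : ℝ => ∑ i ∈ Finset.range n, a i * t ^ (Λ (i+1) - 1 - l)) =
            ∑ i ∈ Finset.range n, fun (t : ℝ) => a i * t ^ (Λ (i+1) - 1 - l) := by
          ext t
          simp
        rw [e]
        exact this
      rw [intervalIntegral.integral_sub (hint _) hsum,
        intervalIntegral.integral_finsetSum (fun i _ => (hint _).const_mul _), mul_sub,
        hval q (fun h => hlq (by linarith)), Finset.mul_sum, Finset.sum_range_succ]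
      have e1 : ∀ i ∈ Finset.range n, x ^ l * ∫ t in x..1, a i * t ^ (Λ (i+1) - 1 - l) =
          a i * ((x ^ l - x ^ Λ (i+1)) / (Λ (i+1) - l)) := by
        intro i hi
        rw [intervalIntegral.integral_const_mul, ← hval _ (hmu i hi)]
        ring
      rw [Finset.sum_congr rfl e1]
      have e2 : ∀ i ∈ Finset.range n, (if i = n then
        1 + ∑ i ∈ Finset.range n, a i * ((l - q) / (Λ (i+1) - l))
        else - (a i * ((l - q) / (Λ (i+1) - l)))) * x ^ (Λ (i+1)) =
          (l - q) * (a i * ((x ^ l - x ^ Λ (i+1)) / (Λ (i+1) - l))) -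
          a i * ((l - q) / (Λ (i+1) - l)) * x ^ l := by
        intro i hi
        rw [if_neg (by rw [Finset.mem_range] at hi; omega)]
        ring
      rw [Finset.sum_congr rfl e2, Finset.sum_sub_distrib, ← Finset.sum_mul, ← Finset.mul_sum,
        if_pos rfl, ← hl]
      have e3 : (l - q) * ((x ^ l - x ^ q) / (q - l)) = x ^ q - x ^ l := by
        have : q - l ≠ 0 := fun h => hlq (by linarith)
        field_simp
        ring
      rw [mul_sub, e3]
      ring
    rw [hI, Finset.prod_range_succ, ← hC, ← hl]
    have hC0 : 0 ≤ C := Finset.prod_nonneg fun _ _ => abs_nonneg _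
    have hb : |∫ t in x..1,
          (t ^ (q - 1 - l) - ∑ i ∈ Finset.range n, a i * t ^ (Λ (i+1) - 1 - l))| ≤
        ∫ t in x..1, C * t ^ (- 1 - l) := by
      rw [← Real.norm_eq_abs]
      refine intervalIntegral.norm_integral_le_of_norm_le hx1 ?_ ((hint _).const_mul _)
      refine Filter.Eventually.of_forall fun t ht => ?_
      have ht0 : 0 < t := hx.trans ht.1
      have hr : ∀ m : ℝ, t ^ (m - 1 - l) = t ^ m * t ^ (-1 - l) := by
        intro m
        rw [← Real.rpow_add ht0]
        congr 1
        ring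
      simp only [hr, ← mul_assoc]
      rw [← Finset.sum_mul, ← sub_mul, norm_mul, Real.norm_eq_abs, Real.norm_eq_abs,
        abs_of_pos (Real.rpow_pos_of_pos ht0 (-1 - l))]
      exact mul_le_mul_of_nonneg_right (ha t ht0 ht.2) (Real.rpow_nonneg ht0.le _)
    have hxl : 0 < x ^ l := Real.rpow_pos_of_pos hx l
    have h4 : x ^ l * ∫ t in x..1, C * t ^ (- 1 - l) ≤ C / l := by
      have := hval 0 (by linarith)
      rw [zero_sub, Real.rpow_zero] at this
      rw [intervalIntegral.integral_const_mul, mul_left_comm, this, div_eq_mul_inv C]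
      refine mul_le_mul_of_nonneg_left ?_ hC0
      rw [zero_sub, div_neg, ← neg_div, inv_eq_one_div]
      gcongr
      linarith
    rw [abs_mul, abs_mul, abs_of_pos hxl]
    calc |l - q| * (x ^ l * _) ≤ |l - q| * (C / l) :=
          mul_le_mul_of_nonneg_left
            ((mul_le_mul_of_nonneg_left hb hxl.le).trans h4) (abs_nonneg _)
      _ = C * |1 - q / l| := by
          rw [show 1 - q / l = (l - q) / l by field_simp, abs_div, abs_of_pos hlpos]
          ring

lemma prod_small (Λ : ℕ → ℝ) (hpos : ∀ i, 0 < Λ (i+1))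
    (htop : Tendsto Λ atTop atTop)
    (hdiv : (∑' i : ℕ, ENNReal.ofReal (1 / Λ (i+1))) = ⊤) (q : ℝ) (hq : 0 < q) :
    Tendsto (fun n => ∏ i ∈ Finset.range n, |1 - q / Λ (i+1)|) atTop (nhds 0) := by
  have hS : Tendsto (fun n => ∑ i ∈ Finset.range n, 1 / Λ (i+1)) atTop atTop := by
    rw [← not_summable_iff_tendsto_nat_atTop_of_nonneg (fun i => (one_div_pos.2 (hpos i)).le)]
    intro hs
    rw [← ENNReal.ofReal_tsum_of_nonneg (fun i => (one_div_pos.2 (hpos i)).le) hs] at hdiv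
    exact ENNReal.ofReal_ne_top hdiv
  obtain ⟨N, hN⟩ := (htop.eventually_ge_atTop q).exists_forall_of_atTop
  set S := fun n => ∑ i ∈ Finset.range n, 1 / Λ (i+1) with hSdef
  set P := fun n => ∏ i ∈ Finset.range n, |1 - q / Λ (i+1)| with hP
  have hP0 : ∀ n, 0 ≤ P n := fun n => Finset.prod_nonneg fun _ _ => abs_nonneg _
  have key : ∀ n, N ≤ n → P n ≤ P N * Real.exp (q * S N) * Real.exp (-(q * S n)) := by
    intro n hn
    induction n, hn using Nat.le_induction with
    | base => rw [mul_assoc, ← Real.exp_add]; simp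
    | succ n hn ih =>
      have h1 : P (n+1) = P n * |1 - q / Λ (n+1)| := Finset.prod_range_succ _ _
      have h2 : S (n+1) = S n + 1 / Λ (n+1) := Finset.sum_range_succ _ _
      have h3 : |1 - q / Λ (n+1)| ≤ Real.exp (-(q * (1 / Λ (n+1)))) := by
        have : q / Λ (n+1) ≤ 1 := (div_le_one (hpos n)).2 (hN _ (by omega))
        rw [abs_of_nonneg (by linarith), mul_one_div]
        have := Real.add_one_le_exp (-(q / Λ (n+1)))
        linarith
      rw [h1, h2, mul_add, neg_add, Real.exp_add, ← mul_assoc]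
      exact mul_le_mul ih h3 (abs_nonneg _) ((hP0 n).trans ih)
  refine squeeze_zero' (Eventually.of_forall hP0) ((eventually_ge_atTop N).mono key) ?_
  rw [← mul_zero (P N * Real.exp (q * S N))]
  exact (Real.tendsto_exp_neg_atTop_nhds_zero.comp (hS.const_mul_atTop hq)).const_mul _

def MApp (Λ : ℕ → ℝ) (g : ℝ → ℝ) : Prop :=
  ∀ ε : ℝ, 0 < ε → ∃ p ∈ Submodule.span ℝ (Set.range fun (i : ℕ) (x : ℝ) => x ^ (Λ i)),
    ∀ x ∈ Set.Icc (0:ℝ) 1, |g x - p x| < ε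

lemma MApp.add {Λ : ℕ → ℝ} {g h : ℝ → ℝ} (hg : MApp Λ g) (hh : MApp Λ h) :
    MApp Λ (fun x => g x + h x) := by
  intro ε hε
  obtain ⟨p, hp, hp'⟩ := hg (ε/2) (half_pos hε)
  obtain ⟨r, hr, hr'⟩ := hh (ε/2) (half_pos hε)
  refine ⟨p + r, Submodule.add_mem _ hp hr, fun x hx => ?_⟩
  have h1 := abs_lt.1 (hp' x hx)
  have h2 := abs_lt.1 (hr' x hx)
  rw [Pi.add_apply, abs_lt]
  constructor <;> linarith

lemma MApp.smul {Λ : ℕ → ℝ} {g : ℝ → ℝ} (c : ℝ) (hg : MApp Λ g) :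
    MApp Λ (fun x => c * g x) := by
  intro ε hε
  have hc : 0 < |c| + 1 := by positivity
  obtain ⟨p, hp, hp'⟩ := hg (ε/(|c|+1)) (div_pos hε hc)
  refine ⟨c • p, Submodule.smul_mem _ c hp, fun x hx => ?_⟩
  have h1 := hp' x hx
  rw [lt_div_iff₀ hc] at h1
  rw [Pi.smul_apply, smul_eq_mul, ← mul_sub, abs_mul]
  nlinarith [abs_nonneg (g x - p x), abs_nonneg c]

lemma MApp.monomial (Λ : ℕ → ℝ) (h0 : Λ 0 = 0) (hmono : StrictMono Λ)
    (htop : Tendsto Λ atTop atTop)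
    (hdiv : (∑' i : ℕ, ENNReal.ofReal (1 / Λ (i+1))) = ⊤) (k : ℕ) :
    MApp Λ (fun x => x ^ k) := by
  have hpos : ∀ i, 0 < Λ (i+1) := fun i => h0 ▸ hmono (Nat.succ_pos i)
  by_cases hk : ∃ i, (k:ℝ) = Λ i
  · obtain ⟨i, hi⟩ := hk
    intro ε hε
    refine ⟨fun x => x ^ (Λ i), Submodule.subset_span ⟨i, rfl⟩, fun x hx => ?_⟩
    simp only [← hi, Real.rpow_natCast, sub_self, abs_zero, hε]
  · push Not at hk
    have hk0 : k ≠ 0 := by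
      rintro rfl
      exact hk 0 (by simp [h0])
    intro ε hε
    obtain ⟨n, hn⟩ := ((prod_small Λ hpos htop hdiv k (by positivity)).eventually_lt_const
      hε).exists
    obtain ⟨a, ha⟩ := golitschek Λ hpos hmono k (Nat.cast_nonneg k) hk n
    refine ⟨∑ i ∈ Finset.range n, a i • fun x : ℝ => x ^ (Λ (i+1)),
      Submodule.sum_mem _ fun i _ => Submodule.smul_mem _ _ (Submodule.subset_span ⟨i+1, rfl⟩),
      fun x hx => ?_⟩
    rw [Finset.sum_apply]
    simp only [Pi.smul_apply, smul_eq_mul]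
    rcases hx.1.eq_or_lt with rfl | hx0
    · rw [Finset.sum_eq_zero fun i _ => by rw [Real.zero_rpow (hpos i).ne', mul_zero]]
      simpa [hk0] using hε
    · have := ha x hx0 hx.2
      rw [Real.rpow_natCast] at this
      exact this.trans_lt hn

/-- **Müntz–Szász theorem in `C([0,1])`.**
If `0 = Λ 0 < Λ 1 < ⋯ → ∞` and `∑_{i ≥ 1} 1 / Λ i = +∞`, then the linear span of the power
functions `x ↦ x ^ (Λ i)` is dense in the space of continuous functions on `[0,1]` with
the supremum norm: every continuous function on `[0,1]` can be uniformly approximated by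
Müntz polynomials `∑ aᵢ x ^ (Λ i)`. -/
theorem muntz_szasz_C (Λ : ℕ → ℝ) (h0 : Λ 0 = 0) (hmono : StrictMono Λ)
    (htop : Tendsto Λ atTop atTop)
    (hdiv : (∑' i : ℕ, ENNReal.ofReal (1 / Λ (i+1))) = ⊤) :
    ∀ f : ℝ → ℝ, ContinuousOn f (Set.Icc (0:ℝ) 1) → ∀ ε : ℝ, 0 < ε →
      ∃ (n : ℕ) (a : ℕ → ℝ), ∀ x ∈ Set.Icc (0:ℝ) 1,
        |f x - ∑ i ∈ Finset.range (n+1), a i * x ^ (Λ i)| < ε := by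
  intro f hf ε hε
  obtain ⟨P, hP⟩ := exists_polynomial_near_of_continuousOn 0 1 f hf (ε/2) (half_pos hε)
  have hA : ∀ P : Polynomial ℝ, MApp Λ (fun x => P.eval x) := by
    intro P
    induction P using Polynomial.induction_on' with
    | add p r hp hr => simpa only [Polynomial.eval_add] using hp.add hr
    | monomial k c =>
      simpa only [Polynomial.eval_monomial] using
        (MApp.monomial Λ h0 hmono htop hdiv k).smul c
  obtain ⟨p, hp, hp'⟩ := hA P (ε/2) (half_pos hε)
  obtain ⟨c, rfl⟩ := Finsupp.mem_span_range_iff_exists_finsupp.1 hp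
  refine ⟨c.support.sup id, c, fun x hx => ?_⟩
  have hs : ∑ i ∈ Finset.range (c.support.sup id + 1), c i * x ^ (Λ i) =
      (c.sum fun i a => a • fun x : ℝ => x ^ (Λ i)) x := by
    rw [Finsupp.sum, Finset.sum_apply]
    symm
    refine Finset.sum_subset (fun i hi => ?_) (fun i _ hi => ?_)
    · exact Finset.mem_range.2 (Nat.lt_succ_of_le (Finset.le_sup (f := id) hi))
    · simp [Finsupp.notMem_support_iff.1 hi]
  have h1 := abs_lt.1 (hP x hx)
  have h2 := abs_lt.1 (hp' x hx)
  rw [hs, abs_lt]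
  constructor <;> linarith
end

section
/- Let λ > 0 be a real number and x ∈ [0,1]. Then L_n(x; λ) = P_n^{(0, 1/λ − 1)}(2x^λ − 1), i.e. Σ_{i=0}^n [(−1)^{n−i} / (λ^n i! (n−i)!)] ∏_{k=0}^{n−1}((i+k)λ + 1) · x^{iλ} = Σ_{i=0}^n [(−1)^{n−i} (1+b)_n (1+a+b)_{i+n} / (i! (n−i)! (1+b)_i (1+a+b)_n)] · x^{iλ}, where a = 0 and b = 1/λ − 1. -/
/-- **Müntz–Legendre polynomials via Jacobi polynomials.**
Let `λ > 0` and `x ∈ [0,1]`. Then `L_n(x; λ) = P_n^{(0, 1/λ - 1)}(2 x^λ - 1)`, i.e.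
`∑_{i=0}^n [(-1)^{n-i} / (λ^n i! (n-i)!)] ∏_{k=0}^{n-1} ((i+k)λ + 1) · x^{iλ}`
equals
`∑_{i=0}^n [(-1)^{n-i} (1+b)_n (1+a+b)_{i+n} / (i! (n-i)! (1+b)_i (1+a+b)_n)] · x^{iλ}`,
where `a = 0`, `b = 1/λ - 1`, and `(c)_m = ∏_{k=0}^{m-1} (c + k)` is the rising factorial
(note that with these parameters `((1 + (2x^λ - 1))/2)^i = x^{iλ}`). -/
theorem muntzLegendre_eq_jacobi (lam : ℝ) (hlam : 0 < lam) (x : ℝ)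
    (hx : x ∈ Set.Icc (0:ℝ) 1) (n : ℕ) (a b : ℝ) (ha : a = 0) (hb : b = 1/lam - 1) :
    ∑ i ∈ Finset.range (n+1),
      ((-1:ℝ)^(n-i) / (lam^n * (Nat.factorial i : ℝ) * (Nat.factorial (n-i) : ℝ))) *
        (∏ k ∈ Finset.range n, (((i:ℝ) + (k:ℝ)) * lam + 1)) * x ^ ((i:ℝ) * lam)
    = ∑ i ∈ Finset.range (n+1),
      ((-1:ℝ)^(n-i) * (∏ k ∈ Finset.range n, (1 + b + (k:ℝ))) *
          (∏ k ∈ Finset.range (i+n), (1 + a + b + (k:ℝ))) /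
        ((Nat.factorial i : ℝ) * (Nat.factorial (n-i) : ℝ) *
          (∏ k ∈ Finset.range i, (1 + b + (k:ℝ))) *
          (∏ k ∈ Finset.range n, (1 + a + b + (k:ℝ))))) * x ^ ((i:ℝ) * lam) := by
  have hl : lam ≠ 0 := hlam.ne'
  have hc : 1 + a + b = 1 / lam := by rw [ha, hb]; ring
  have hc' : 1 + b = 1 / lam := by rw [hb]; ring
  simp only [hc, hc']
  refine Finset.sum_congr rfl fun i _ => ?_
  congr 1
  have hpos : ∀ m : ℕ, (∏ k ∈ Finset.range m, (1 / lam + (k:ℝ))) ≠ 0 := fun m =>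
    (Finset.prod_pos fun k _ => by positivity).ne'
  have h1 : (∏ k ∈ Finset.range n, (((i:ℝ) + (k:ℝ)) * lam + 1))
      = lam ^ n * ∏ k ∈ Finset.range n, (1 / lam + ((i + k : ℕ) : ℝ)) := by
    have h2 : ∀ k ∈ Finset.range n, (((i:ℝ) + (k:ℝ)) * lam + 1)
        = lam * (1 / lam + ((i + k : ℕ) : ℝ)) := by
      intro k _
      push_cast
      field_simp
      ring
    rw [Finset.prod_congr rfl h2, Finset.prod_mul_distrib]
    simp
  rw [h1, Finset.prod_range_add]
  have hi := hpos i
  have hn := hpos n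
  have hf1 : (Nat.factorial i : ℝ) ≠ 0 := by positivity
  have hf2 : (Nat.factorial (n - i) : ℝ) ≠ 0 := by positivity
  have hln : lam ^ n ≠ 0 := pow_ne_zero n hl
  generalize (∏ k ∈ Finset.range n, (1 / lam + ((i + k : ℕ) : ℝ))) = C
  generalize (∏ k ∈ Finset.range i, (1 / lam + (k:ℝ))) = A at *
  generalize (∏ k ∈ Finset.range n, (1 / lam + (k:ℝ))) = B at *
  field_simp
end

section
/- Let 0 ≤ λ₀ < λ₁ < λ₂ < ⋯ be distinct nonnegative real numbers and define, for each n, the Müntz–Legendre polynomial L_n(x) = Σ_{i=0}^n η_{n,i} x^{λ_i} with η_{n,i} = ∏_{k=0}^{n−1}(λ_i + λ_k + 1) / ∏_{k=0, k≠i}^{n}(λ_i − λ_k). Then for all n, m ∈ ℕ, ∫₀¹ L_n(x) L_m(x) dx = δ_{n,m} / (2λ_n + 1), where δ_{n,m} is the Kronecker delta. -/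
open Finset Polynomial in
lemma ml_partial_fraction (Λ : ℕ → ℝ) (hmono : StrictMono Λ) (n : ℕ) (μ : ℝ)
    (hpos : ∀ i, 0 < Λ i + μ + 1) :
    ∑ i ∈ Finset.range (n+1),
        ((∏ k ∈ Finset.range n, (Λ i + Λ k + 1)) /
          (∏ k ∈ (Finset.range (n+1)).erase i, (Λ i - Λ k))) * (1 / (Λ i + μ + 1))
    = (∏ k ∈ Finset.range n, (μ - Λ k)) / ∏ k ∈ Finset.range (n+1), (Λ k + μ + 1) := by
  set P : ℝ[X] := ∏ k ∈ Finset.range n, (X - C (-(Λ k + 1))) with hP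
  have hdeg : P.degree < #(Finset.range (n+1)) := by
    rw [hP, ← Lagrange.nodal_eq (Finset.range n) (fun k => -(Λ k + 1)), Lagrange.degree_nodal]
    simp only [Finset.card_range]
    exact_mod_cast Nat.lt_succ_self n
  have hne : ∀ i ∈ Finset.range (n+1), -(μ + 1) ≠ Λ i := by
    intro i _ h
    have := hpos i
    linarith
  have hPe : ∀ y, P.eval y = ∏ k ∈ Finset.range n, (y + Λ k + 1) := by
    intro y
    rw [hP, eval_prod]
    refine Finset.prod_congr rfl fun k _ => ?_
    simp only [eval_sub, eval_X, eval_C]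
    ring
  have h1 := Lagrange.eq_interpolate (v := Λ) hmono.injective.injOn hdeg
  have h2 := congrArg (eval (-(μ+1))) h1
  rw [Lagrange.eval_interpolate_not_at_node _ hne, Lagrange.eval_nodal] at h2
  have e1 : P.eval (-(μ+1)) = (-1)^n * ∏ k ∈ Finset.range n, (μ - Λ k) := by
    rw [hPe]
    conv_rhs => rw [← Finset.card_range n, ← Finset.prod_const, Finset.card_range,
      ← Finset.prod_mul_distrib]
    exact Finset.prod_congr rfl fun k _ => by ring
  have e2 : ∏ k ∈ Finset.range (n+1), (-(μ+1) - Λ k)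
      = (-1)^(n+1) * ∏ k ∈ Finset.range (n+1), (Λ k + μ + 1) := by
    conv_rhs => rw [← Finset.card_range (n+1), ← Finset.prod_const, Finset.card_range,
      ← Finset.prod_mul_distrib]
    exact Finset.prod_congr rfl fun k _ => by ring
  have e3 : ∑ i ∈ Finset.range (n+1), Lagrange.nodalWeight (Finset.range (n+1)) Λ i *
      (-(μ+1) - Λ i)⁻¹ * P.eval (Λ i) = - ∑ i ∈ Finset.range (n+1),
        ((∏ k ∈ Finset.range n, (Λ i + Λ k + 1)) /
          (∏ k ∈ (Finset.range (n+1)).erase i, (Λ i - Λ k))) * (1 / (Λ i + μ + 1)) := by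
    rw [← Finset.sum_neg_distrib]
    refine Finset.sum_congr rfl fun i _ => ?_
    rw [hPe, Lagrange.nodalWeight, Finset.prod_inv_distrib,
      show -(μ+1) - Λ i = -(Λ i + μ + 1) by ring, inv_neg]
    ring
  rw [e1, e2, e3] at h2
  have hD : ∏ k ∈ Finset.range (n+1), (Λ k + μ + 1) ≠ 0 :=
    Finset.prod_ne_zero_iff.mpr fun k _ => (hpos k).ne'
  rw [eq_div_iff hD]
  have hs : ((-1:ℝ)^n) ≠ 0 := by simp
  apply mul_left_cancel₀ hs
  rw [h2, pow_succ]
  ring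

lemma ml_integral (Λ : ℕ → ℝ) (hnn : ∀ i, 0 ≤ Λ i) (s t : Finset ℕ) (a b : ℕ → ℝ) :
    (∫ x in (0:ℝ)..1, (∑ i ∈ s, a i * x ^ (Λ i)) * (∑ j ∈ t, b j * x ^ (Λ j)))
    = ∑ j ∈ t, b j * ∑ i ∈ s, a i * (1 / (Λ i + Λ j + 1)) := by
  have h1 : ∀ x ∈ Set.uIcc (0:ℝ) 1,
      (∑ i ∈ s, a i * x ^ (Λ i)) * (∑ j ∈ t, b j * x ^ (Λ j))
      = ∑ j ∈ t, ∑ i ∈ s, (b j * a i) * x ^ (Λ i + Λ j) := by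
    intro x hx
    rw [Set.uIcc_of_le zero_le_one] at hx
    rw [Finset.sum_mul_sum, Finset.sum_comm]
    refine Finset.sum_congr rfl fun j _ => Finset.sum_congr rfl fun i _ => ?_
    rw [Real.rpow_add_of_nonneg hx.1 (hnn i) (hnn j)]
    ring
  have hi : ∀ i j, IntervalIntegrable (fun x : ℝ => (b j * a i) * x ^ (Λ i + Λ j))
      MeasureTheory.volume 0 1 := fun i j =>
    (intervalIntegral.intervalIntegrable_rpow (Or.inl (add_nonneg (hnn i) (hnn j)))).const_mul _
  rw [intervalIntegral.integral_congr h1, intervalIntegral.integral_finsetSum]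
  · refine Finset.sum_congr rfl fun j _ => ?_
    rw [intervalIntegral.integral_finsetSum fun i _ => hi i j, Finset.mul_sum]
    refine Finset.sum_congr rfl fun i _ => ?_
    have := hnn i
    have := hnn j
    rw [intervalIntegral.integral_const_mul, integral_rpow (Or.inl (by linarith)),
      Real.one_rpow, Real.zero_rpow (by linarith)]
    ring
  · intro j _
    have he : (fun x : ℝ => ∑ i ∈ s, (b j * a i) * x ^ (Λ i + Λ j))
        = ∑ i ∈ s, fun x : ℝ => (b j * a i) * x ^ (Λ i + Λ j) := by
      funext x
      simp
    rw [he]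
    exact IntervalIntegrable.sum s fun i _ => hi i j

lemma ml_aux (Λ : ℕ → ℝ) (h0 : 0 ≤ Λ 0) (hmono : StrictMono Λ)
    (n m : ℕ) (hmn : m ≤ n) :
    (∫ x in (0:ℝ)..1,
      (∑ i ∈ Finset.range (n+1),
        ((∏ k ∈ Finset.range n, (Λ i + Λ k + 1)) /
          (∏ k ∈ (Finset.range (n+1)).erase i, (Λ i - Λ k))) * x ^ (Λ i)) *
      (∑ i ∈ Finset.range (m+1),
        ((∏ k ∈ Finset.range m, (Λ i + Λ k + 1)) /
          (∏ k ∈ (Finset.range (m+1)).erase i, (Λ i - Λ k))) * x ^ (Λ i)))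
    = (if n = m then (1:ℝ) else 0) / (2 * Λ n + 1) := by
  have hnn : ∀ i, 0 ≤ Λ i := fun i => h0.trans (hmono.monotone (Nat.zero_le i))
  have hpos : ∀ j i, 0 < Λ i + Λ j + 1 := fun j i => by
    have := hnn i
    have := hnn j
    linarith
  rw [ml_integral Λ hnn]
  simp only [ml_partial_fraction Λ hmono n _ (hpos _)]
  have hz : ∀ j, j < n → ∏ k ∈ Finset.range n, (Λ j - Λ k) = 0 := fun j hj =>
    Finset.prod_eq_zero (Finset.mem_range.mpr hj) (sub_self _)
  rw [Finset.sum_range_succ, Finset.sum_eq_zero, zero_add]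
  · rcases hmn.eq_or_lt with rfl | hlt
    · have he : (Finset.range (m+1)).erase m = Finset.range m := by
        rw [Finset.range_add_one, Finset.erase_insert Finset.notMem_range_self]
      have hA : ∏ k ∈ Finset.range m, (Λ m - Λ k) ≠ 0 :=
        Finset.prod_ne_zero_iff.mpr fun k hk =>
          (sub_pos.mpr (hmono (Finset.mem_range.mp hk))).ne'
      have hB : ∏ k ∈ Finset.range m, (Λ m + Λ k + 1) ≠ 0 :=
        Finset.prod_ne_zero_iff.mpr fun k _ => (hpos k m).ne'
      have hC : 2 * Λ m + 1 ≠ 0 := by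
        have := hnn m
        positivity
      rw [he, Finset.prod_range_succ (fun k => Λ k + Λ m + 1), if_pos rfl,
        Finset.prod_congr rfl fun k _ => show Λ k + Λ m + 1 = Λ m + Λ k + 1 by ring,
        show Λ m + Λ m + 1 = 2 * Λ m + 1 by ring]
      field_simp
    · rw [hz m hlt, if_neg hlt.ne']
      simp
  · intro j hj
    rw [hz j (lt_of_lt_of_le (Finset.mem_range.mp hj) hmn)]
    simp

/-- **Orthogonality of the Müntz–Legendre polynomials.**
For distinct exponents `0 ≤ Λ 0 < Λ 1 < ⋯`, the Müntz–Legendre polynomials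
`L_n(x) = ∑_{i=0}^n η_{n,i} x^{Λ i}` with
`η_{n,i} = ∏_{k=0}^{n-1} (Λ i + Λ k + 1) / ∏_{k=0, k≠i}^{n} (Λ i - Λ k)`
satisfy `∫₀¹ L_n(x) L_m(x) dx = δ_{n,m} / (2 Λ n + 1)`. -/
theorem muntzLegendre_orthogonality (Λ : ℕ → ℝ) (h0 : 0 ≤ Λ 0) (hmono : StrictMono Λ)
    (n m : ℕ) :
    (∫ x in (0:ℝ)..1,
      (∑ i ∈ Finset.range (n+1),
        ((∏ k ∈ Finset.range n, (Λ i + Λ k + 1)) /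
          (∏ k ∈ (Finset.range (n+1)).erase i, (Λ i - Λ k))) * x ^ (Λ i)) *
      (∑ i ∈ Finset.range (m+1),
        ((∏ k ∈ Finset.range m, (Λ i + Λ k + 1)) /
          (∏ k ∈ (Finset.range (m+1)).erase i, (Λ i - Λ k))) * x ^ (Λ i)))
    = (if n = m then (1:ℝ) else 0) / (2 * Λ n + 1) := by
  rcases le_total m n with h | h
  · exact ml_aux Λ h0 hmono n m h
  · have := ml_aux Λ h0 hmono m n h
    simp only [mul_comm (Finset.sum (Finset.range (m+1)) _)] at this
    rw [this]
    by_cases hnm : n = m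
    · subst hnm
      rfl
    · rw [if_neg hnm, if_neg (Ne.symm hnm)]
      simp
end

section
/- Let λ > 0 and define L_n(x; λ) = Σ_{i=0}^n [(−1)^{n−i} / (λ^n i! (n−i)!)] ∏_{k=0}^{n−1}((i+k)λ + 1) · x^{iλ} for x ∈ [0,1]. Then L_0(x; λ) = 1, L_1(x; λ) = (1/λ + 1)x^λ − 1/λ, and for every n ≥ 1, d_{1,n} L_{n+1}(x; λ) = d_{2,n}(x) L_n(x; λ) − d_{3,n} L_{n−1}(x; λ), where, writing s = 1/λ − 1, d_{1,n} = 2(n+1)(n+s+1)(2n+s), d_{2,n}(x) = (2n+s+1)[(2n+s)(2n+s+2)(2x^λ − 1) − s²], and d_{3,n} = 2n(n+s)(2n+s+2). -/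
/-- The Müntz–Legendre polynomial `L_n(x; λ) = ∑_{i=0}^n η_{n,i} x^{iλ}` with
`η_{n,i} = (-1)^{n-i} / (λ^n i! (n-i)!) · ∏_{k=0}^{n-1} ((i+k)λ + 1)`. -/
noncomputable def muntzLegendre (lam : ℝ) (n : ℕ) (x : ℝ) : ℝ :=
  ∑ i ∈ Finset.range (n+1),
    ((-1:ℝ)^(n-i) / (lam^n * (Nat.factorial i : ℝ) * (Nat.factorial (n-i) : ℝ))) *
      (∏ k ∈ Finset.range n, (((i:ℝ) + (k:ℝ)) * lam + 1)) * x ^ ((i:ℝ) * lam)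


/-- Rising product. -/
noncomputable def mlR (s : ℝ) (n : ℕ) (y : ℝ) : ℝ := ∏ k ∈ Finset.range n, (y + (k:ℝ) + s + 1)

/-- Coefficients in the variable `t = x ^ lam`. -/
noncomputable def mlC (s : ℝ) (n i : ℕ) : ℝ :=
  (-1:ℝ)^(n+i) * (n.choose i : ℝ) / (n.factorial : ℝ) * mlR s n i

theorem mlR_succ (s : ℝ) (n : ℕ) (y : ℝ) : mlR s (n+1) y = mlR s n y * (y + n + s + 1) := by
  unfold mlR
  rw [Finset.prod_range_succ]

theorem mlR_succ_left (s : ℝ) (n : ℕ) (y : ℝ) :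
    mlR s (n+1) y = mlR s n (y+1) * (y + s + 1) := by
  unfold mlR
  rw [Finset.prod_range_succ']
  congr 1
  · apply Finset.prod_congr rfl
    intro k _
    push_cast
    ring
  · simp

theorem ml_choose (n j : ℕ) (h : j ≤ n + 1) :
    (n.choose j : ℝ) = ((n:ℝ) + 1 - j) * ((n+1).choose j : ℝ) / ((n:ℝ)+1) := by
  have h1 := Nat.choose_mul_succ_eq n j
  have h2 : ((n.choose j * (n+1) : ℕ) : ℝ) = (((n+1).choose j * (n+1-j) : ℕ) : ℝ) := by rw [h1]
  rw [Nat.cast_mul, Nat.cast_mul, Nat.cast_sub h] at h2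
  push_cast at h2
  have : (n:ℝ) + 1 ≠ 0 := by positivity
  field_simp
  linarith

theorem ml_choose_zero (n j : ℕ) (h : j ≤ n + 2) :
    (n.choose j : ℝ) * ((n:ℝ)+1) = ((n:ℝ) + 1 - j) * ((n+1).choose j : ℝ) := by
  have hn : (n:ℝ) + 1 ≠ 0 := by positivity
  rcases Nat.lt_or_ge (n+1) j with h1 | h1
  · rw [Nat.choose_eq_zero_of_lt h1, Nat.choose_eq_zero_of_lt (by omega : n < j)]
    simp
  · rw [ml_choose n j h1]
    field_simp

theorem mlC_rec (s : ℝ) (m i : ℕ) (hi : i ≤ m + 1) :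
    (2 * ((m:ℝ)+1+1) * ((m:ℝ)+1+s+1) * (2*((m:ℝ)+1)+s)) * mlC s (m+2) (i+1)
      = (2*((m:ℝ)+1)+s+1) * (2*((m:ℝ)+1)+s) * (2*((m:ℝ)+1)+s+2) * 2 * mlC s (m+1) i
        - (2*((m:ℝ)+1)+s+1) * ((2*((m:ℝ)+1)+s) * (2*((m:ℝ)+1)+s+2) + s^2) * mlC s (m+1) (i+1)
        - (2 * ((m:ℝ)+1) * ((m:ℝ)+1+s) * (2*((m:ℝ)+1)+s+2)) * mlC s m (i+1) := by
  have hm1 : (m:ℝ) + 1 ≠ 0 := by positivity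
  have hm2 : (m:ℝ) + 2 ≠ 0 := by positivity
  have hf : (m.factorial : ℝ) ≠ 0 := by positivity
  have e1 : ((m+1).choose (i+1) : ℝ)
      = ((m:ℝ) + 1 - i) * ((m+2).choose (i+1) : ℝ) / ((m:ℝ)+2) := by
    rw [eq_div_iff hm2]
    have := ml_choose_zero (m+1) (i+1) (by omega)
    push_cast at this
    linear_combination this
  have e2 : (m.choose (i+1) : ℝ)
      = ((m:ℝ) - i) * ((m:ℝ) + 1 - i) * ((m+2).choose (i+1) : ℝ) / (((m:ℝ)+2) * ((m:ℝ)+1)) := by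
    have := ml_choose_zero m (i+1) (by omega)
    rw [e1] at this
    push_cast at this
    rw [eq_div_iff (mul_ne_zero hm2 hm1)]
    field_simp at this
    linear_combination this
  have e3 : ((m+1).choose i : ℝ) = ((i:ℝ) + 1) * ((m+2).choose (i+1) : ℝ) / ((m:ℝ)+2) := by
    have h1 := Nat.add_one_mul_choose_eq (m+1) i
    have h2 : (((m+1+1) * (m+1).choose i : ℕ) : ℝ)
      = (((m+1+1).choose (i+1) * (i+1) : ℕ) : ℝ) := by rw [h1]
    push_cast at h2
    rw [eq_div_iff hm2]
    linear_combination h2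
  have f1 : ((m+1).factorial : ℝ) = ((m:ℝ)+1) * m.factorial := by
    rw [Nat.factorial_succ]; push_cast; ring
  have f2 : ((m+2).factorial : ℝ) = ((m:ℝ)+2) * (((m:ℝ)+1) * m.factorial) := by
    rw [Nat.factorial_succ, Nat.cast_mul, f1]; push_cast; ring
  unfold mlC
  rw [e1, e2, e3, f1, f2, mlR_succ_left s m (i:ℝ), mlR_succ s (m+1), mlR_succ s m]
  push_cast
  generalize mlR s m ((i:ℝ)+1) = R
  generalize ((m+2).choose (i+1) : ℝ) = C
  have p1 : (-1:ℝ)^(m+2+(i+1)) = -(-1:ℝ)^(m+i) := by ring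
  have p2 : (-1:ℝ)^(m+1+i) = -(-1:ℝ)^(m+i) := by ring
  have p3 : (-1:ℝ)^(m+1+(i+1)) = (-1:ℝ)^(m+i) := by ring
  have p4 : (-1:ℝ)^(m+(i+1)) = -(-1:ℝ)^(m+i) := by ring
  rw [p1, p2, p3, p4]
  generalize (-1:ℝ)^(m+i) = e
  generalize (m.factorial : ℝ) = F at *
  field_simp
  ring

theorem mlC_rec_zero (s : ℝ) (m : ℕ) :
    (2 * ((m:ℝ)+1+1) * ((m:ℝ)+1+s+1) * (2*((m:ℝ)+1)+s)) * mlC s (m+2) 0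
      = - (2*((m:ℝ)+1)+s+1) * ((2*((m:ℝ)+1)+s) * (2*((m:ℝ)+1)+s+2) + s^2) * mlC s (m+1) 0
        - (2 * ((m:ℝ)+1) * ((m:ℝ)+1+s) * (2*((m:ℝ)+1)+s+2)) * mlC s m 0 := by
  have hm1 : (m:ℝ) + 1 ≠ 0 := by positivity
  have hm2 : (m:ℝ) + 2 ≠ 0 := by positivity
  have hf : (m.factorial : ℝ) ≠ 0 := by positivity
  have f1 : ((m+1).factorial : ℝ) = ((m:ℝ)+1) * m.factorial := by
    rw [Nat.factorial_succ]; push_cast; ring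
  have f2 : ((m+2).factorial : ℝ) = ((m:ℝ)+2) * (((m:ℝ)+1) * m.factorial) := by
    rw [Nat.factorial_succ, Nat.cast_mul, f1]; push_cast; ring
  unfold mlC
  rw [f1, f2, mlR_succ s (m+1), mlR_succ s m]
  simp only [Nat.choose_zero_right, add_zero]
  push_cast
  generalize mlR s m 0 = R
  generalize (m.factorial : ℝ) = F at *
  rw [pow_add (-1:ℝ) m 2, pow_add (-1:ℝ) m 1]
  generalize (-1:ℝ)^m = e
  field_simp
  ring

theorem mlC_zero (s : ℝ) (n i : ℕ) (h : n < i) : mlC s n i = 0 := by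
  unfold mlC
  rw [Nat.choose_eq_zero_of_lt h]
  simp

theorem ml_eq (lam : ℝ) (hlam : 0 < lam) (x : ℝ) (hx : 0 ≤ x) (s : ℝ) (hs : s = 1/lam - 1)
    (n : ℕ) : muntzLegendre lam n x = ∑ i ∈ Finset.range (n+1), mlC s n i * (x^lam)^i := by
  unfold muntzLegendre
  apply Finset.sum_congr rfl
  intro i hi
  have hin : i ≤ n := Nat.lt_succ_iff.mp (Finset.mem_range.mp hi)
  have h1 : x ^ ((i:ℝ) * lam) = (x^lam)^i := by
    rw [mul_comm, Real.rpow_mul hx, Real.rpow_natCast]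
  have h2 : (∏ k ∈ Finset.range n, (((i:ℝ) + (k:ℝ)) * lam + 1)) = lam^n * mlR s n i := by
    unfold mlR
    rw [← Finset.card_range n, ← Finset.prod_const, Finset.card_range, ← Finset.prod_mul_distrib]
    apply Finset.prod_congr rfl
    intro k _
    rw [hs]
    field_simp
    ring
  have h3 : (-1:ℝ)^(n+i) = (-1:ℝ)^(n-i) := by
    obtain ⟨d, rfl⟩ := Nat.exists_eq_add_of_le hin
    rw [Nat.add_sub_cancel_left, show i + d + i = 2*i + d by ring, pow_add, pow_mul]
    simp
  rw [h1, h2, mlC, h3, Nat.cast_choose ℝ hin]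
  congr 1
  have : (n.factorial : ℝ) ≠ 0 := by positivity
  have : (i.factorial : ℝ) ≠ 0 := by positivity
  have : ((n-i).factorial : ℝ) ≠ 0 := by positivity
  field_simp

theorem ml_sum_ext (s t : ℝ) (n N : ℕ) (h : n + 1 ≤ N) :
    ∑ i ∈ Finset.range (n+1), mlC s n i * t^i = ∑ i ∈ Finset.range N, mlC s n i * t^i := by
  apply Finset.sum_subset (Finset.range_mono h)
  intro i _ hi
  rw [mlC_zero s n i (by simpa using hi)]
  simp

/-- **Three-term recurrence for the Müntz–Legendre polynomials.**
For `λ > 0` and `x ∈ [0,1]`: `L_0(x; λ) = 1`, `L_1(x; λ) = (1/λ + 1) x^λ - 1/λ`, and for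
every `n ≥ 1`, writing `s = 1/λ - 1`,
`d_{1,n} L_{n+1}(x; λ) = d_{2,n}(x) L_n(x; λ) - d_{3,n} L_{n-1}(x; λ)` where
`d_{1,n} = 2(n+1)(n+s+1)(2n+s)`,
`d_{2,n}(x) = (2n+s+1) [(2n+s)(2n+s+2)(2x^λ - 1) - s²]`,
`d_{3,n} = 2n(n+s)(2n+s+2)`. -/
theorem muntzLegendre_recurrence (lam : ℝ) (hlam : 0 < lam) (x : ℝ)
    (hx : x ∈ Set.Icc (0:ℝ) 1) (s : ℝ) (hs : s = 1/lam - 1) :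
    muntzLegendre lam 0 x = 1 ∧
    muntzLegendre lam 1 x = (1/lam + 1) * x ^ lam - 1/lam ∧
    ∀ n : ℕ, 1 ≤ n →
      (2 * ((n:ℝ)+1) * ((n:ℝ)+s+1) * (2*(n:ℝ)+s)) * muntzLegendre lam (n+1) x
        = ((2*(n:ℝ)+s+1) * ((2*(n:ℝ)+s) * (2*(n:ℝ)+s+2) * (2 * x ^ lam - 1) - s^2)) *
            muntzLegendre lam n x
          - (2 * (n:ℝ) * ((n:ℝ)+s) * (2*(n:ℝ)+s+2)) * muntzLegendre lam (n-1) x := by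
  have hx0 : 0 ≤ x := hx.1
  refine ⟨?_, ?_, ?_⟩
  · simp [muntzLegendre]
  · simp [muntzLegendre, Finset.sum_range_succ]
    field_simp
    ring
  · intro n hn
    obtain ⟨m, rfl⟩ : ∃ m, n = m + 1 := ⟨n - 1, by omega⟩
    rw [Nat.add_sub_cancel, ml_eq lam hlam x hx0 s hs, ml_eq lam hlam x hx0 s hs,
      ml_eq lam hlam x hx0 s hs]
    generalize x ^ lam = t
    have key : (2*((m:ℝ)+1)+s+1) * (2*((m:ℝ)+1)+s) * (2*((m:ℝ)+1)+s+2) * 2 *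
          (t * ∑ i ∈ Finset.range (m+1+1), mlC s (m+1) i * t^i)
        = (2 * ((m:ℝ)+1+1) * ((m:ℝ)+1+s+1) * (2*((m:ℝ)+1)+s)) *
            ∑ i ∈ Finset.range (m+1+1+1), mlC s (m+2) i * t^i
          + (2*((m:ℝ)+1)+s+1) * ((2*((m:ℝ)+1)+s) * (2*((m:ℝ)+1)+s+2) + s^2) *
            ∑ i ∈ Finset.range (m+1+1), mlC s (m+1) i * t^i
          + (2 * ((m:ℝ)+1) * ((m:ℝ)+1+s) * (2*((m:ℝ)+1)+s+2)) *
            ∑ i ∈ Finset.range (m+1), mlC s m i * t^i := by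
      conv_rhs => rw [ml_sum_ext s t (m+1) (m+1+1+1) (by omega),
        ml_sum_ext s t m (m+1+1+1) (by omega)]
      rw [Finset.sum_range_succ' _ (m+1+1), Finset.sum_range_succ' _ (m+1+1),
        Finset.sum_range_succ' _ (m+1+1)]
      have hsum := Finset.sum_congr (rfl : Finset.range (m+1+1) = Finset.range (m+1+1))
        (fun i hi => congrArg (fun z => z * t^(i+1))
          (mlC_rec s m i (Nat.lt_succ_iff.mp (Finset.mem_range.mp hi))))
      simp only [sub_mul, mul_assoc, Finset.sum_sub_distrib, ← Finset.mul_sum] at hsum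
      have ht : ∑ i ∈ Finset.range (m+1+1), mlC s (m+1) i * t^(i+1)
          = t * ∑ i ∈ Finset.range (m+1+1), mlC s (m+1) i * t^i := by
        rw [Finset.mul_sum]
        apply Finset.sum_congr rfl
        intro i _
        ring
      rw [ht] at hsum
      have h0 := mlC_rec_zero s m
      linear_combination -hsum - h0
    push_cast
    linear_combination -key
end
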